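/- Under Assumptions 1 and 2, the approximate prediction step (using the backward finite-difference time derivative) incurs a one-step error bound: with x_{k+1|k} = x_k − h·[∇ₓₓ f(x_k;t_k)]⁻¹ ∇̃_{tx} f(x_k;t_k) and ∇̃_{tx} f(x_k;t_k) = (∇ₓ f(x_k;t_k) − ∇ₓ f(x_k;t_{k−1}))/h, we have ‖x_{k+1|k} − x*(t_{k+1})‖ ≤ σ·‖x_k − x*(t_k)‖ + (h²/2)·(C₀²C₁/m³ + 2C₀C₂/m² + 2C₃/m), where σ := 1 + h·(C₀C₁/m² + C₂/m). -/

import Mathlib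

noncomputable section

/-- The setting of a time-varying, smooth, strongly convex optimization problem
`min_{x ∈ ℝⁿ} f(x;t)`, bundling the objective `f`, its derivatives, the Hessian
inverse, the optimal trajectory `x*(t)`, and Assumptions 1 and 2 of the paper. -/
structure TVOpt (n : ℕ) where
  /-- the objective `f(x;t)` -/
  f : EuclideanSpace ℝ (Fin n) → ℝ → ℝ
  /-- the gradient `∇ₓ f(x;t)` -/
  grad : EuclideanSpace ℝ (Fin n) → ℝ → EuclideanSpace ℝ (Fin n)
  /-- the Hessian `∇ₓₓ f(x;t)` -/
  hess : EuclideanSpace ℝ (Fin n) → ℝ →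
    EuclideanSpace ℝ (Fin n) →L[ℝ] EuclideanSpace ℝ (Fin n)
  /-- the Hessian inverse `[∇ₓₓ f(x;t)]⁻¹` -/
  hessInv : EuclideanSpace ℝ (Fin n) → ℝ →
    EuclideanSpace ℝ (Fin n) →L[ℝ] EuclideanSpace ℝ (Fin n)
  /-- the mixed partial derivative `∇_{tx} f(x;t)` -/
  dtgrad : EuclideanSpace ℝ (Fin n) → ℝ → EuclideanSpace ℝ (Fin n)
  /-- the third derivative tensor `∇ₓₓₓ f(x;t)` -/
  d3 : EuclideanSpace ℝ (Fin n) → ℝ →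
    EuclideanSpace ℝ (Fin n) →L[ℝ] EuclideanSpace ℝ (Fin n) →L[ℝ] EuclideanSpace ℝ (Fin n)
  /-- the time derivative of the Hessian `∇_{xtx} f(x;t)` -/
  dthess : EuclideanSpace ℝ (Fin n) → ℝ →
    EuclideanSpace ℝ (Fin n) →L[ℝ] EuclideanSpace ℝ (Fin n)
  /-- the second time derivative of the gradient `∇_{ttx} f(x;t)` -/
  dttgrad : EuclideanSpace ℝ (Fin n) → ℝ → EuclideanSpace ℝ (Fin n)
  /-- the optimal trajectory `x*(t)` -/
  xstar : ℝ → EuclideanSpace ℝ (Fin n)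
  /-- strong convexity constant -/
  m : ℝ
  /-- Hessian norm bound (gradient Lipschitz constant) -/
  L : ℝ
  C0 : ℝ
  C1 : ℝ
  C2 : ℝ
  C3 : ℝ
  m_pos : 0 < m
  grad_spec : ∀ (x : EuclideanSpace ℝ (Fin n)) (t : ℝ), HasGradientAt (fun y => f y t) (grad x t) x
  hess_spec : ∀ (x : EuclideanSpace ℝ (Fin n)) (t : ℝ), HasFDerivAt (fun y => grad y t) (hess x t) x
  dtgrad_spec : ∀ (x : EuclideanSpace ℝ (Fin n)) (t : ℝ), HasDerivAt (fun s => grad x s) (dtgrad x t) t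
  d3_spec : ∀ (x : EuclideanSpace ℝ (Fin n)) (t : ℝ), HasFDerivAt (fun y => hess y t) (d3 x t) x
  dthess_spec : ∀ (x : EuclideanSpace ℝ (Fin n)) (t : ℝ), HasDerivAt (fun s => hess x s) (dthess x t) t
  dttgrad_spec : ∀ (x : EuclideanSpace ℝ (Fin n)) (t : ℝ), HasDerivAt (fun s => dtgrad x s) (dttgrad x t) t
  /-- Assumption 1: `∇ₓₓ f(x;t) ⪰ m·I` uniformly in `x` and `t`. -/
  strong_convex : ∀ (x : EuclideanSpace ℝ (Fin n)) (t : ℝ) (v : EuclideanSpace ℝ (Fin n)),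
    m * ‖v‖ ^ 2 ≤ @inner ℝ _ _ v (hess x t v)
  hessInv_left : ∀ (x : EuclideanSpace ℝ (Fin n)) (t : ℝ), ContinuousLinearMap.comp (hessInv x t) (hess x t) =
    ContinuousLinearMap.id ℝ (EuclideanSpace ℝ (Fin n))
  hessInv_right : ∀ (x : EuclideanSpace ℝ (Fin n)) (t : ℝ), ContinuousLinearMap.comp (hess x t) (hessInv x t) =
    ContinuousLinearMap.id ℝ (EuclideanSpace ℝ (Fin n))
  /-- Assumption 2: bounded derivatives, uniformly in `x` and `t`. -/
  hess_bound : ∀ (x : EuclideanSpace ℝ (Fin n)) (t : ℝ), ‖hess x t‖ ≤ L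
  dtgrad_bound : ∀ (x : EuclideanSpace ℝ (Fin n)) (t : ℝ), ‖dtgrad x t‖ ≤ C0
  d3_bound : ∀ (x : EuclideanSpace ℝ (Fin n)) (t : ℝ), ‖d3 x t‖ ≤ C1
  dthess_bound : ∀ (x : EuclideanSpace ℝ (Fin n)) (t : ℝ), ‖dthess x t‖ ≤ C2
  dttgrad_bound : ∀ (x : EuclideanSpace ℝ (Fin n)) (t : ℝ), ‖dttgrad x t‖ ≤ C3
  /-- `x*(t)` minimizes `f(·;t)` -/
  xstar_min : ∀ t : ℝ, IsMinOn (fun x => f x t) Set.univ (xstar t)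
  /-- equivalently, `∇ₓ f(x*(t);t) = 0` -/
  xstar_grad : ∀ t : ℝ, grad (xstar t) t = 0

theorem norm_sub_sub_deriv_le_half {E : Type*} [NormedAddCommGroup E] [NormedSpace ℝ E]
    {F F' : ℝ → E} {K : ℝ} (hF : ∀ s, HasDerivAt F (F' s) s)
    (hK : ∀ s, 0 ≤ s → ‖F' s - F' 0‖ ≤ K * s) : ‖F 1 - F 0 - F' 0‖ ≤ K / 2 := by
  have hG : ∀ s, HasDerivAt (fun s => F s - F 0 - s • F' 0) (F' s - F' 0) s := fun s => by
    refine (((hF s).sub_const (F 0)).sub ((hasDerivAt_id s).smul_const (F' 0))).congr_deriv ?_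
    rw [one_smul]
  have hB : ∀ s : ℝ, HasDerivAt (fun s => K / 2 * s ^ 2) (K * s) s := fun s => by
    refine ((hasDerivAt_pow 2 s).const_mul (K / 2)).congr_deriv ?_
    push_cast
    ring
  have key := image_norm_le_of_norm_deriv_right_le_deriv_boundary
    (a := 0) (b := 1) (fun s _ => (hG s).continuousAt.continuousWithinAt)
    (fun s _ => (hG s).hasDerivWithinAt) (by simp) hB (fun s hs => hK s hs.1)
    (Set.right_mem_Icc.mpr zero_le_one)
  simpa using key

namespace TVOpt

variable {n : ℕ} (P : TVOpt n)

theorem C1_nonneg : 0 ≤ P.C1 := (norm_nonneg (P.d3 0 0)).trans (P.d3_bound 0 0)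

theorem C2_nonneg : 0 ≤ P.C2 := (norm_nonneg _).trans (P.dthess_bound 0 0)

theorem hess_hessInv (x : EuclideanSpace ℝ (Fin n)) (t : ℝ) (w : EuclideanSpace ℝ (Fin n)) :
    P.hess x t (P.hessInv x t w) = w :=
  DFunLike.congr_fun (P.hessInv_right x t) w

theorem hessInv_hess (x : EuclideanSpace ℝ (Fin n)) (t : ℝ) (w : EuclideanSpace ℝ (Fin n)) :
    P.hessInv x t (P.hess x t w) = w :=
  DFunLike.congr_fun (P.hessInv_left x t) w

theorem norm_hessInv_le (x : EuclideanSpace ℝ (Fin n)) (t : ℝ) (w : EuclideanSpace ℝ (Fin n)) :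
    ‖P.hessInv x t w‖ ≤ ‖w‖ / P.m := by
  have h1 := P.strong_convex x t (P.hessInv x t w)
  rw [hess_hessInv] at h1
  have h2 := real_inner_le_norm (P.hessInv x t w) w
  rw [le_div_iff₀ P.m_pos]
  rcases (norm_nonneg (P.hessInv x t w)).eq_or_lt with h0 | h0
  · simp [← h0]
  · refine le_of_mul_le_mul_left ?_ h0
    linarith

theorem norm_hess_sub_space_le (x y : EuclideanSpace ℝ (Fin n)) (t : ℝ) :
    ‖P.hess x t - P.hess y t‖ ≤ P.C1 * ‖x - y‖ :=
  convex_univ.norm_image_sub_le_of_norm_hasFDerivWithin_le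
    (fun z _ => (P.d3_spec z t).hasFDerivWithinAt) (fun z _ => P.d3_bound z t)
    (Set.mem_univ y) (Set.mem_univ x)

theorem norm_hess_sub_time_le (x : EuclideanSpace ℝ (Fin n)) (s t : ℝ) :
    ‖P.hess x s - P.hess x t‖ ≤ P.C2 * ‖s - t‖ :=
  convex_univ.norm_image_sub_le_of_norm_hasDerivWithin_le
    (fun r _ => (P.dthess_spec x r).hasDerivWithinAt) (fun r _ => P.dthess_bound x r)
    (Set.mem_univ t) (Set.mem_univ s)

theorem norm_grad_sub_time_le (x : EuclideanSpace ℝ (Fin n)) (s t : ℝ) :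
    ‖P.grad x s - P.grad x t‖ ≤ P.C0 * ‖s - t‖ :=
  convex_univ.norm_image_sub_le_of_norm_hasDerivWithin_le
    (fun r _ => (P.dtgrad_spec x r).hasDerivWithinAt) (fun r _ => P.dtgrad_bound x r)
    (Set.mem_univ t) (Set.mem_univ s)

theorem norm_dtgrad_sub_time_le (x : EuclideanSpace ℝ (Fin n)) (s t : ℝ) :
    ‖P.dtgrad x s - P.dtgrad x t‖ ≤ P.C3 * ‖s - t‖ :=
  convex_univ.norm_image_sub_le_of_norm_hasDerivWithin_le
    (fun r _ => (P.dttgrad_spec x r).hasDerivWithinAt) (fun r _ => P.dttgrad_bound x r)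
    (Set.mem_univ t) (Set.mem_univ s)

theorem norm_grad_mixed_difference_le (x y : EuclideanSpace ℝ (Fin n)) (s t : ℝ) :
    ‖(P.grad x s - P.grad x t) - (P.grad y s - P.grad y t)‖ ≤ P.C2 * ‖s - t‖ * ‖x - y‖ :=
  convex_univ.norm_image_sub_le_of_norm_hasFDerivWithin_le
    (f := fun z => P.grad z s - P.grad z t)
    (fun z _ => ((P.hess_spec z s).sub (P.hess_spec z t)).hasFDerivWithinAt)
    (fun z _ => P.norm_hess_sub_time_le z s t) (Set.mem_univ y) (Set.mem_univ x)

theorem norm_dtgrad_sub_space_le (x y : EuclideanSpace ℝ (Fin n)) (t : ℝ) :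
    ‖P.dtgrad x t - P.dtgrad y t‖ ≤ P.C2 * ‖x - y‖ := by
  refine ((P.dtgrad_spec x t).sub (P.dtgrad_spec y t)).le_of_lip'
    (mul_nonneg P.C2_nonneg (norm_nonneg _)) (Filter.Eventually.of_forall fun s => ?_)
  have h1 := P.norm_grad_mixed_difference_le x y s t
  simp only [Pi.sub_apply]
  rw [sub_sub_sub_comm]
  linarith

theorem norm_sub_le_norm_grad_sub (x y : EuclideanSpace ℝ (Fin n)) (t : ℝ) :
    P.m * ‖x - y‖ ≤ ‖P.grad x t - P.grad y t‖ := by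
  have hd : ∀ s : ℝ, HasDerivAt (fun s : ℝ => inner ℝ (x - y) (P.grad (y + s • (x - y)) t))
      (inner ℝ (x - y) (P.hess (y + s • (x - y)) t (x - y))) s := fun s => by
    have hl : HasDerivAt (fun s : ℝ => y + s • (x - y)) (x - y) s := by
      simpa using ((hasDerivAt_id s).smul_const (x - y)).const_add y
    have hg := (P.hess_spec (y + s • (x - y)) t).comp_hasDerivAt s hl
    simpa using (hasDerivAt_const s (x - y)).inner ℝ hg
  obtain ⟨c, -, hc⟩ := exists_hasDerivAt_eq_slope _ _ (zero_lt_one' ℝ)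
    (fun s _ => (hd s).continuousAt.continuousWithinAt) (fun s _ => hd s)
  have h1 := P.strong_convex (y + c • (x - y)) t (x - y)
  rw [hc] at h1
  have h2 := real_inner_le_norm (x - y) (P.grad x t - P.grad y t)
  simp only [one_smul, add_sub_cancel, zero_smul, add_zero, sub_zero, div_one,
    ← inner_sub_right] at h1
  rcases (norm_nonneg (x - y)).eq_or_lt with h0 | h0
  · simp [← h0]
  · refine le_of_mul_le_mul_left ?_ h0
    linarith

theorem norm_xstar_sub_le (s t : ℝ) : ‖P.xstar s - P.xstar t‖ ≤ P.C0 * ‖s - t‖ / P.m := by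
  rw [le_div_iff₀ P.m_pos, mul_comm]
  refine (P.norm_sub_le_norm_grad_sub _ _ s).trans ?_
  rw [P.xstar_grad s, ← P.xstar_grad t, norm_sub_rev]
  exact P.norm_grad_sub_time_le _ s t

theorem norm_grad_taylor_space_le (x y : EuclideanSpace ℝ (Fin n)) (t : ℝ) :
    ‖P.grad y t - P.grad x t - P.hess x t (y - x)‖ ≤ P.C1 * ‖y - x‖ ^ 2 / 2 := by
  have hd : ∀ s : ℝ, HasDerivAt (fun s : ℝ => P.grad (x + s • (y - x)) t)
      (P.hess (x + s • (y - x)) t (y - x)) s := fun s => by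
    have hl : HasDerivAt (fun s : ℝ => x + s • (y - x)) (y - x) s := by
      simpa using ((hasDerivAt_id s).smul_const (y - x)).const_add x
    exact (P.hess_spec (x + s • (y - x)) t).comp_hasDerivAt s hl
  have key := norm_sub_sub_deriv_le_half (K := P.C1 * ‖y - x‖ ^ 2) hd fun s hs => by
    rw [← sub_apply]
    refine (ContinuousLinearMap.le_of_opNorm_le _ (P.norm_hess_sub_space_le _ _ t) _).trans_eq ?_
    simp only [zero_smul, add_zero, add_sub_cancel_left, norm_smul, Real.norm_of_nonneg hs]
    ring
  simpa using key

theorem norm_grad_taylor_time_le (x : EuclideanSpace ℝ (Fin n)) (t h : ℝ) :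
    ‖P.grad x (t + h) - P.grad x t - h • P.dtgrad x t‖ ≤ P.C3 * h ^ 2 / 2 := by
  have hd : ∀ s : ℝ, HasDerivAt (fun s : ℝ => P.grad x (t + s * h))
      (h • P.dtgrad x (t + s * h)) s := fun s => by
    have hl : HasDerivAt (fun s : ℝ => t + s * h) h s := by
      simpa using ((hasDerivAt_id s).mul_const h).const_add t
    exact (P.dtgrad_spec x (t + s * h)).scomp s hl
  have key := norm_sub_sub_deriv_le_half (K := P.C3 * h ^ 2) hd fun s hs => by
    rw [← smul_sub, norm_smul]
    refine (mul_le_mul_of_nonneg_left (P.norm_dtgrad_sub_time_le _ _ _)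
      (norm_nonneg _)).trans_eq ?_
    simp only [zero_mul, add_zero, add_sub_cancel_left, norm_mul, Real.norm_of_nonneg hs]
    rw [← sq_abs h, Real.norm_eq_abs]
    ring
  simpa using key

theorem norm_xstar_taylor_le (t h : ℝ) (hh : 0 ≤ h) :
    ‖P.xstar (t + h) - P.xstar t + h • P.hessInv (P.xstar t) t (P.dtgrad (P.xstar t) t)‖ ≤
      h ^ 2 / 2 * (P.C0 ^ 2 * P.C1 / P.m ^ 3 + 2 * P.C0 * P.C2 / P.m ^ 2 + P.C3 / P.m) := by
  have hm := P.m_pos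
  set x := P.xstar t
  set y := P.xstar (t + h)
  have hgx : P.grad x t = 0 := P.xstar_grad t
  have hgy : P.grad y (t + h) = 0 := P.xstar_grad (t + h)
  have hd : ‖y - x‖ ≤ P.C0 * h / P.m := by
    simpa [abs_of_nonneg hh] using P.norm_xstar_sub_le (t + h) t
  have h1 := P.norm_grad_taylor_space_le x y t
  have h2 := P.norm_grad_mixed_difference_le y x (t + h) t
  rw [add_sub_cancel_left, Real.norm_of_nonneg hh] at h2
  have h3 := P.norm_grad_taylor_time_le x t h
  have heq : y - x + h • P.hessInv x t (P.dtgrad x t) =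
      -P.hessInv x t ((P.grad y t - P.grad x t - P.hess x t (y - x)) +
        ((P.grad y (t + h) - P.grad y t) - (P.grad x (t + h) - P.grad x t)) +
        (P.grad x (t + h) - P.grad x t - h • P.dtgrad x t)) := by
    rw [hgx, hgy, ← P.hessInv_hess x t (y - x), ← map_smul, ← map_add, ← map_neg,
      P.hess_hessInv]
    congr 1
    abel
  rw [heq, norm_neg]
  refine (P.norm_hessInv_le _ _ _).trans ?_
  have h4 : P.C1 * ‖y - x‖ ^ 2 / 2 ≤ P.C1 * (P.C0 * h / P.m) ^ 2 / 2 := by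
    have := P.C1_nonneg
    gcongr
  have h5 : P.C2 * h * ‖y - x‖ ≤ P.C2 * h * (P.C0 * h / P.m) :=
    mul_le_mul_of_nonneg_left hd (mul_nonneg P.C2_nonneg hh)
  calc _ ≤ (P.C1 * (P.C0 * h / P.m) ^ 2 / 2 + P.C2 * h * (P.C0 * h / P.m) +
        P.C3 * h ^ 2 / 2) / P.m :=
        div_le_div_of_nonneg_right (norm_add₃_le.trans (by linarith)) hm.le
    _ = _ := by field_simp

theorem norm_newton_direction_sub_le (x y : EuclideanSpace ℝ (Fin n)) (t : ℝ) :
    ‖P.hessInv x t (P.dtgrad x t) - P.hessInv y t (P.dtgrad y t)‖ ≤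
      (P.C0 * P.C1 / P.m ^ 2 + P.C2 / P.m) * ‖x - y‖ := by
  have hm := P.m_pos
  set v := P.hessInv y t (P.dtgrad y t) with hv
  have hvn : ‖v‖ ≤ P.C0 / P.m :=
    (P.norm_hessInv_le _ _ _).trans (div_le_div_of_nonneg_right (P.dtgrad_bound y t) hm.le)
  have heq : P.hessInv x t (P.dtgrad x t) - v =
      P.hessInv x t ((P.dtgrad x t - P.dtgrad y t) - (P.hess x t - P.hess y t) v) := by
    rw [sub_apply, hv, P.hess_hessInv, sub_sub_sub_cancel_right, map_sub,
      P.hessInv_hess]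
  have h1 : ‖(P.hess x t - P.hess y t) v‖ ≤ P.C1 * ‖x - y‖ * (P.C0 / P.m) :=
    (ContinuousLinearMap.le_of_opNorm_le _ (P.norm_hess_sub_space_le x y t) v).trans
      (mul_le_mul_of_nonneg_left hvn (mul_nonneg P.C1_nonneg (norm_nonneg _)))
  rw [heq]
  refine (P.norm_hessInv_le _ _ _).trans ?_
  calc _ ≤ (P.C2 * ‖x - y‖ + P.C1 * ‖x - y‖ * (P.C0 / P.m)) / P.m :=
        div_le_div_of_nonneg_right
          ((norm_sub_le _ _).trans (add_le_add (P.norm_dtgrad_sub_space_le x y t) h1)) hm.le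
    _ = _ := by field_simp; ring

end TVOpt

/-- One-step error bound of the approximate prediction step (using
the backward finite-difference time derivative): the same bound as the exact
prediction, with `2C₃/m` in place of `C₃/m`. -/
theorem approximate_prediction_one_step_error (n : ℕ) (P : TVOpt n) (h : ℝ) (hh : 0 < h) :
    ∀ (k : ℕ) (xk : EuclideanSpace ℝ (Fin n)),
      ‖(xk - h • P.hessInv xk ((k : ℝ) * h)
            (h⁻¹ • (P.grad xk ((k : ℝ) * h) - P.grad xk ((k : ℝ) * h - h))))
          - P.xstar (((k : ℝ) + 1) * h)‖ ≤
        (1 + h * (P.C0 * P.C1 / P.m ^ 2 + P.C2 / P.m)) * ‖xk - P.xstar ((k : ℝ) * h)‖ +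
        h ^ 2 / 2 *
          (P.C0 ^ 2 * P.C1 / P.m ^ 3 + 2 * P.C0 * P.C2 / P.m ^ 2 + 2 * P.C3 / P.m) := by
  intro k x
  have hm := P.m_pos
  rw [show ((k : ℝ) + 1) * h = k * h + h by ring]
  generalize (k : ℝ) * h = t
  have h1 := P.norm_newton_direction_sub_le x (P.xstar t) t
  have h2 := P.norm_xstar_taylor_le t h hh.le
  have h3 : ‖P.hessInv x t (P.grad x (t - h) - P.grad x t + h • P.dtgrad x t)‖ ≤
      P.C3 * h ^ 2 / 2 / P.m := by
    refine (P.norm_hessInv_le _ _ _).trans (div_le_div_of_nonneg_right ?_ hm.le)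
    simpa [← sub_eq_add_neg] using P.norm_grad_taylor_time_le x t (-h)
  have h4 : ‖h • (P.hessInv x t (P.dtgrad x t) -
      P.hessInv (P.xstar t) t (P.dtgrad (P.xstar t) t))‖ ≤
      h * ((P.C0 * P.C1 / P.m ^ 2 + P.C2 / P.m) * ‖x - P.xstar t‖) := by
    rw [norm_smul, Real.norm_of_nonneg hh.le]
    exact mul_le_mul_of_nonneg_left h1 hh.le
  have heq : x - h • P.hessInv x t (h⁻¹ • (P.grad x t - P.grad x (t - h))) - P.xstar (t + h) =
      (x - P.xstar t) + P.hessInv x t (P.grad x (t - h) - P.grad x t + h • P.dtgrad x t) -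
      h • (P.hessInv x t (P.dtgrad x t) -
        P.hessInv (P.xstar t) t (P.dtgrad (P.xstar t) t)) -
      (P.xstar (t + h) - P.xstar t +
        h • P.hessInv (P.xstar t) t (P.dtgrad (P.xstar t) t)) := by
    rw [map_smul, smul_inv_smul₀ hh.ne']
    simp only [map_add, map_sub, map_smul, smul_sub]
    abel
  rw [heq]
  refine (norm_sub_le _ _).trans ((add_le_add_left (norm_sub_le _ _) _).trans
    ((add_le_add_left (add_le_add_left (norm_add_le _ _) _) _).trans ?_))
  refine (add_le_add (add_le_add (add_le_add le_rfl h3) h4) h2).trans_eq ?_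
  ring
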